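/- arXiv:1203.4112 — 2 statements merged into one kernel-verified Lean document; each statement's English description precedes it below -/
import Mathlib

section
/- Let A be a Poisson algebra over a commutative ring k, let (H_i)_{i ∈ ι} be a family of elements of A, and let I be the ring ideal of A generated by the elements H_i; assume {H_i, H_j} ∈ I for all i, j ∈ ι. If f, g ∈ A satisfy {f, H_i} = 0 and {g, H_i} = 0 for all i ∈ ι, then for all u, v ∈ I one has {f + u, g + v} − {f, g} ∈ I. In particular the Poisson bracket induces a well-defined bracket on the image of the set {f ∈ A : {f, H_i} = 0 for all i} in the quotient ring A/I. (This is the algebraic core of the Poisson reduction theorem, establishing the induced Poisson structure on the reduced space.) -/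
/-- A derivation-like additive map sending a set of generators of an ideal into that ideal
preserves the ideal. -/
theorem map_mem_span_of_leibniz {A F : Type*} [CommRing A] [FunLike F A A]
    [AddMonoidHomClass F A A] (D : F) (hD : ∀ y z : A, D (y * z) = D y * z + y * D z)
    {s : Set A} (hs : ∀ x ∈ s, D x ∈ Ideal.span s) {v : A} (hv : v ∈ Ideal.span s) :
    D v ∈ Ideal.span s := by
  induction hv using Submodule.span_induction with
  | mem x hx => exact hs x hx
  | zero => simp
  | add x y _ _ hx hy => rw [map_add]; exact add_mem hx hy
  | smul a x hx ih =>
    rw [smul_eq_mul, hD]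
    exact add_mem (Ideal.mul_mem_left _ _ hx) (Ideal.mul_mem_left _ _ ih)

/-- Algebraic core of the Poisson reduction theorem: if `{f, Hᵢ} = 0 = {g, Hᵢ}`
for all `i`, then `{f + u, g + v} − {f, g}` lies in the ideal generated by the
`Hᵢ` for all `u, v` in that ideal, so the bracket descends to the quotient. -/
theorem stmt_3 {k : Type*} [CommRing k] {A : Type*} [CommRing A] [Algebra k A]
    (P : A →ₗ[k] A →ₗ[k] A)
    (hanti : ∀ x y : A, P x y = -P y x)
    (hjac : ∀ x y z : A, P x (P y z) + P y (P z x) + P z (P x y) = 0)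
    (hleib : ∀ x y z : A, P x (y * z) = P x y * z + y * P x z)
    {ι : Type*} (H : ι → A)
    (hHH : ∀ i j : ι, P (H i) (H j) ∈ Ideal.span (Set.range H))
    (f g : A)
    (hf : ∀ i : ι, P f (H i) = 0)
    (hg : ∀ i : ι, P g (H i) = 0) :
    ∀ u ∈ Ideal.span (Set.range H), ∀ v ∈ Ideal.span (Set.range H),
      P (f + u) (g + v) - P f g ∈ Ideal.span (Set.range H) := by
  intro u hu v hv
  have bracket_mem : ∀ x : A, (∀ i, P x (H i) ∈ Ideal.span (Set.range H)) →
      ∀ w ∈ Ideal.span (Set.range H), P x w ∈ Ideal.span (Set.range H) := fun x hx w hw =>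
    map_mem_span_of_leibniz (P x) (hleib x) (Set.forall_mem_range.2 hx) hw
  have hfv := bracket_mem f (fun i => by simp [hf i]) v hv
  have hgu := bracket_mem g (fun i => by simp [hg i]) u hu
  have huv := bracket_mem u (fun i => by
    rw [hanti]
    exact neg_mem (bracket_mem (H i) (hHH i) u hu)) v hv
  have expand : P (f + u) (g + v) - P f g = P f v - P g u + P u v := by
    simp only [map_add, LinearMap.add_apply, hanti u g]
    ring
  rw [expand]
  exact add_mem (sub_mem hfv hgu) huv
end

section
/- Let A be an associative algebra over a commutative ring k, let a ∈ A be a unit, let q be a unit of k, let μ ∈ k, and let b, c ∈ A satisfy the relations a·b = q²·b·a, a·c = q⁻²·c·a, and b·c = μ·a⁻² + q²·c·b. Then for all f ∈ A one has a⁅b, ⁅c, f⁆·a⁆ − ⁅c, a⁅b, f⁆⁆·a = μ·(a⁻¹fa − afa⁻¹). (With q = e^ħ and μ = ħ²/(e^{−ħ} − e^{ħ}) this is the relation [ξ,η] = (ζ⁻¹ − ζ)/(e^{−ħ} − e^{ħ}) for the generators Φ_ħ(ξ)f = (1/ħ)a⁅b,f⁆, Φ_ħ(η)f = (1/ħ)⁅c,f⁆a,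 Φ_ħ(ζ)f = afa⁻¹ of the Hopf algebra action of U_ħ(su(2)) on the deformed algebra.) -/
/-- The relation `[ξ,η] = (ζ⁻¹ − ζ)/(e^{−ħ} − e^{ħ})` for the generators
`Φ_ħ(ξ)f = (1/ħ)a⁅b,f⁆`, `Φ_ħ(η)f = (1/ħ)⁅c,f⁆a`, `Φ_ħ(ζ)f = afa⁻¹` of the Hopf
algebra action of `U_ħ(su(2))` on the deformed algebra, with `q = e^ħ` and
`μ = ħ²/(e^{−ħ} − e^{ħ})`. -/
theorem stmt_9 {k : Type*} [CommRing k] {A : Type*} [Ring A] [Algebra k A]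
    (a : Aˣ) (q : kˣ) (μ : k) (b c : A)
    (hab : (a : A) * b = ((q : k) ^ 2) • (b * (a : A)))
    (hac : (a : A) * c = (((q⁻¹ : kˣ) : k) ^ 2) • (c * (a : A)))
    (hbc : b * c = μ • ((↑a⁻¹ : A) * (↑a⁻¹ : A)) + ((q : k) ^ 2) • (c * b)) :
    ∀ f : A,
      (a : A) * ⁅b, ⁅c, f⁆ * (a : A)⁆ - ⁅c, (a : A) * ⁅b, f⁆⁆ * (a : A)
        = μ • ((↑a⁻¹ : A) * f * (a : A) - (a : A) * f * (↑a⁻¹ : A)) := by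
  intro f
  have hca : c * (a : A) = ((q : k) ^ 2) • ((a : A) * c) := by
    rw [hac, smul_smul, ← mul_pow, Units.mul_inv, one_pow, one_smul]
  have hleft : (a : A) * b * c - c * a * b = μ • (↑a⁻¹ : A) := by
    rw [hca, mul_assoc, hbc, mul_add, mul_smul_comm, mul_smul_comm, smul_mul_assoc,
      Units.mul_inv_cancel_left, mul_assoc, add_sub_cancel_right]
  have hright : b * c * a - c * (a * b) = μ • (↑a⁻¹ : A) := by
    rw [hab, hbc, add_mul, mul_smul_comm, smul_mul_assoc, smul_mul_assoc,
      Units.inv_mul_cancel_right, mul_assoc c b, add_sub_cancel_right]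
  have hmid : (a : A) * c * f * (a * b) = c * a * f * (b * a) := by
    rw [hca, hab, mul_smul_comm, smul_mul_assoc, smul_mul_assoc]
  calc
    _ = ((a : A) * b * c - c * a * b) * f * a - a * f * (b * c * a - c * (a * b))
        - ((a : A) * c * f * (a * b) - c * a * f * (b * a)) := by
      simp only [Ring.lie_def]
      noncomm_ring
    _ = _ := by
      rw [hleft, hright, hmid, sub_self, sub_zero, smul_mul_assoc, smul_mul_assoc,
        mul_smul_comm, smul_sub]
end
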